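/- For n ≥ 4, the meet (intersection) of all coatoms of L_n equals ∅ if and only if n-1 is squarefree. Moreover, if p is a prime with p² dividing n-1, then the integer 1 + (n-1)/p belongs to every coatom of L_n. -/

import Mathlib

open scoped Classical

/-- An arithmetic progression of integers: a finite set of the form
`{a, a+r, ..., a+(k-1)r}` with `a : ℤ`, `r ≥ 1` and `k ≥ 0` (so the empty set and all
singletons are arithmetic progressions). -/
def IsAP (s : Finset ℤ) : Prop :=
  ∃ (a r : ℤ) (k : ℕ), 1 ≤ r ∧ s = (Finset.range k).image (fun i => a + (i : ℤ) * r)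

/-- The number `p_{nk}` of arithmetic progressions of cardinality `k` contained in `{1,…,n}`. -/
noncomputable def numAP (n k : ℕ) : ℕ :=
  ((Finset.Icc (1:ℤ) (n:ℤ)).powerset.filter (fun s => IsAP s ∧ s.card = k)).card

/-- The Möbius function of the poset of arithmetic progressions ordered by inclusion,
defined by `μ(x,x) = 1` and `μ(x,y) = -∑_{x ≤ z < y} μ(x,z)`, where `z` ranges over
arithmetic progressions with `x ⊆ z ⊂ y`.  (For `x ⊆ y ⊆ {1,…,n}`, all arithmetic
progressions `z` with `x ⊆ z ⊂ y` automatically lie in `L_n`, so this is the Möbius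
function of any interval `[x, y]` of the lattice `L_n`.) -/
noncomputable def apMu (x y : Finset ℤ) : ℤ :=
  if x = y then 1
  else - ∑ z ∈ (y.powerset.filter (fun z => IsAP z ∧ x ⊆ z ∧ z ≠ y)).attach, apMu x z.1
termination_by y.card
decreasing_by
  rename_i z
  have hz := z.2
  rw [Finset.mem_filter, Finset.mem_powerset] at hz
  exact Finset.card_lt_card (lt_of_le_of_ne hz.1 hz.2.2.2)

/-- The join of `a` and `b` in the lattice of arithmetic progressions contained in `t`:
the intersection of all arithmetic progressions contained in `t` that contain `a ∪ b`,
i.e. the smallest such progression. -/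
noncomputable def apJoin (t a b : Finset ℤ) : Finset ℤ :=
  t.filter (fun v => ∀ z : Finset ℤ, IsAP z → z ⊆ t → a ∪ b ⊆ z → v ∈ z)

/-- The meet (intersection) of a finite family `S` of subsets of the top element `t`;
the meet of the empty family is `t` itself. -/
def apMeet (t : Finset ℤ) (S : Finset (Finset ℤ)) : Finset ℤ :=
  S.fold (· ⊓ ·) t id

/-- `x` is a coatom of the lattice `L_n` of arithmetic progressions contained in
`{1,…,n}`: an element distinct from the maximum `{1,…,n}` with no element strictly
between it and the maximum. -/
def IsCoatomIn (n : ℕ) (x : Finset ℤ) : Prop :=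
  IsAP x ∧ x ⊆ Finset.Icc (1:ℤ) (n:ℤ) ∧ x ≠ Finset.Icc (1:ℤ) (n:ℤ) ∧
    ∀ y : Finset ℤ, IsAP y → y ⊆ Finset.Icc (1:ℤ) (n:ℤ) → x ⊂ y → y = Finset.Icc (1:ℤ) (n:ℤ)

/-- `y` is covered by `top` in the poset of arithmetic progressions: `y < top` and there
is no arithmetic progression strictly between them. -/
def CoveredIn (top y : Finset ℤ) : Prop :=
  IsAP y ∧ y ⊂ top ∧ ¬ ∃ z : Finset ℤ, IsAP z ∧ y ⊂ z ∧ z ⊂ top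

/-- `c` is a maximal chain in the lattice `L_n` of arithmetic progressions contained
in `{1,…,n}`: a chain (under inclusion) of elements of `L_n` to which no further
element of `L_n` can be added. -/
def IsMaxChainIn (n : ℕ) (c : Finset (Finset ℤ)) : Prop :=
  (∀ s ∈ c, IsAP s ∧ s ⊆ Finset.Icc (1:ℤ) (n:ℤ)) ∧
  IsChain (· ⊆ ·) (↑c : Set (Finset ℤ)) ∧
  ∀ z : Finset ℤ, IsAP z → z ⊆ Finset.Icc (1:ℤ) (n:ℤ) →
    IsChain (· ⊆ ·) (insert z (↑c : Set (Finset ℤ))) → z ∈ c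

/-- The number `b_{nk}` of chains of length `k` (i.e. totally ordered subsets with `k+1`
elements) in `L_n` that contain both `∅` and `{1,…,n}`. -/
noncomputable def numChains (n k : ℕ) : ℕ :=
  (((Finset.Icc (1:ℤ) (n:ℤ)).powerset.filter IsAP).powerset.filter
    (fun c : Finset (Finset ℤ) => c.card = k + 1 ∧ ∅ ∈ c ∧ Finset.Icc (1:ℤ) (n:ℤ) ∈ c ∧
      IsChain (· ⊆ ·) (↑c : Set (Finset ℤ)))).card

theorem mem_apMeet {t : Finset ℤ} {S : Finset (Finset ℤ)} {v : ℤ} :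
    v ∈ apMeet t S ↔ v ∈ t ∧ ∀ x ∈ S, v ∈ x := by
  unfold apMeet
  induction S using Finset.induction_on with
  | empty => simp
  | insert a s ha ih =>
    rw [Finset.fold_insert ha, Finset.forall_mem_insert, and_left_comm, ← ih]
    exact Finset.mem_inter

/-- The integers in `{1,…,n}` congruent to `1` modulo `d`. -/
noncomputable def residueOne (n : ℕ) (d : ℤ) : Finset ℤ :=
  (Finset.Icc (1:ℤ) (n:ℤ)).filter (fun v => d ∣ v - 1)

theorem mem_residueOne {n : ℕ} {d v : ℤ} :
    v ∈ residueOne n d ↔ (1 ≤ v ∧ v ≤ n) ∧ d ∣ v - 1 := by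
  simp [residueOne]

theorem residueOne_subset (n : ℕ) (d : ℤ) : residueOne n d ⊆ Finset.Icc (1:ℤ) (n:ℤ) :=
  Finset.filter_subset _ _

theorem isAP_iff {s : Finset ℤ} :
    IsAP s ↔ ∃ (a r : ℤ) (k : ℕ), 1 ≤ r ∧
      s = (Finset.range k).image (fun i : ℕ => a + (i : ℤ) * r) := by
  have key (k : ℕ) : (do let i ← Finset.range k; pure (i : ℤ) : Finset ℤ) =
      (Finset.range k).image (fun i : ℕ => (i : ℤ)) := by
    ext v
    simp [Finset.bind_def, Finset.pure_def, eq_comm]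
  simp only [IsAP, key, Finset.image_image, Function.comp_def]

theorem isAP_Icc (a b : ℤ) : IsAP (Finset.Icc a b) := by
  refine isAP_iff.2 ⟨a, 1, (b + 1 - a).toNat, le_rfl, ?_⟩
  ext v
  simp only [Finset.mem_Icc, Finset.mem_image, Finset.mem_range, mul_one]
  constructor
  · rintro ⟨h1, h2⟩
    exact ⟨(v - a).toNat, by omega, by omega⟩
  · rintro ⟨i, hi, rfl⟩
    omega

theorem isAP_residueOne {n : ℕ} (hn : 1 ≤ n) {d : ℤ} (hd : 1 ≤ d) (hdn : d ∣ (n : ℤ) - 1) :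
    IsAP (residueOne n d) := by
  obtain ⟨m, hm⟩ := hdn
  have hm0 : 0 ≤ m := by
    by_contra! h
    have : d * m < 0 := mul_neg_of_pos_of_neg (by omega) h
    omega
  refine isAP_iff.2 ⟨1, d, (m + 1).toNat, hd, ?_⟩
  ext v
  simp only [mem_residueOne, Finset.mem_image, Finset.mem_range]
  constructor
  · rintro ⟨⟨h1, h2⟩, j, hj⟩
    have hj0 : 0 ≤ j := by
      by_contra! h
      have : d * j < 0 := mul_neg_of_pos_of_neg (by omega) h
      omega
    have hjm : j ≤ m := le_of_mul_le_mul_left (by omega : d * j ≤ d * m) (by omega)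
    refine ⟨j.toNat, by omega, ?_⟩
    rw [Int.toNat_of_nonneg hj0]
    linarith
  · rintro ⟨i, hi, rfl⟩
    have him : (i : ℤ) * d ≤ m * d := mul_le_mul_of_nonneg_right (by omega) (by omega)
    have : 0 ≤ (i : ℤ) * d := by positivity
    exact ⟨⟨by linarith, by linarith⟩, i, by ring⟩

theorem IsAP.eq_residueOne {n : ℕ} {y : Finset ℤ} (hy : IsAP y)
    (hyn : y ⊆ Finset.Icc (1:ℤ) (n:ℤ)) (h1 : (1 : ℤ) ∈ y) (hn : (n : ℤ) ∈ y) :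
    ∃ r : ℤ, 1 ≤ r ∧ r ∣ (n : ℤ) - 1 ∧ y = residueOne n r := by
  obtain ⟨a, r, k, hr, rfl⟩ := isAP_iff.1 hy
  obtain ⟨i, hi, hi1⟩ := Finset.mem_image.1 h1
  obtain ⟨l, hl, hln⟩ := Finset.mem_image.1 hn
  rw [Finset.mem_range] at hi hl
  have ha : 1 ≤ a := by
    have := hyn (Finset.mem_image.2 ⟨0, Finset.mem_range.2 (by omega), rfl⟩)
    simpa using (Finset.mem_Icc.1 this).1
  have : 0 ≤ (i : ℤ) * r := by positivity
  obtain rfl : a = 1 := by linarith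
  refine ⟨r, hr, ⟨l, by linarith⟩, ?_⟩
  ext v
  rw [mem_residueOne]
  constructor
  · intro hv
    refine ⟨Finset.mem_Icc.1 (hyn hv), ?_⟩
    obtain ⟨j, -, rfl⟩ := Finset.mem_image.1 hv
    exact ⟨j, by ring⟩
  · rintro ⟨⟨hv1, hv2⟩, j, hj⟩
    have hj0 : 0 ≤ j := by
      by_contra! h
      have : r * j < 0 := mul_neg_of_pos_of_neg (by omega) h
      omega
    have hjl : j ≤ l := le_of_mul_le_mul_left (by linarith : r * j ≤ r * l) (by omega)
    refine Finset.mem_image.2 ⟨j.toNat, Finset.mem_range.2 (by omega), ?_⟩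
    rw [Int.toNat_of_nonneg hj0]
    linarith

theorem isCoatomIn_of_insert {n : ℕ} {x : Finset ℤ} {c : ℤ} (hx : IsAP x) (hc : c ∉ x)
    (h : insert c x = Finset.Icc (1:ℤ) (n:ℤ)) : IsCoatomIn n x := by
  refine ⟨hx, h ▸ Finset.subset_insert c x, ?_, fun y _ hyn hxy => ?_⟩
  · rintro rfl
    exact hc (h ▸ Finset.mem_insert_self c _)
  · refine hyn.antisymm ?_
    obtain ⟨w, hwy, hwx⟩ := Finset.exists_of_ssubset hxy
    have hw := hyn hwy
    rw [← h, Finset.mem_insert, or_iff_left hwx] at hw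
    rw [← h, Finset.insert_subset_iff]
    exact ⟨hw ▸ hwy, hxy.subset⟩

theorem isCoatomIn_Icc_left {n : ℕ} (hn : 1 ≤ n) :
    IsCoatomIn n (Finset.Icc (1:ℤ) ((n:ℤ) - 1)) := by
  refine isCoatomIn_of_insert (c := n) (isAP_Icc _ _) (by simp) ?_
  ext v
  simp only [Finset.mem_insert, Finset.mem_Icc]
  omega

theorem isCoatomIn_Icc_right {n : ℕ} (hn : 1 ≤ n) :
    IsCoatomIn n (Finset.Icc (2:ℤ) (n:ℤ)) := by
  refine isCoatomIn_of_insert (c := 1) (isAP_Icc _ _) (by simp) ?_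
  ext v
  simp only [Finset.mem_insert, Finset.mem_Icc]
  omega

theorem residueOne_ne_Icc {n : ℕ} (hn : 2 ≤ n) {d : ℤ} (hd : 2 ≤ d) :
    residueOne n d ≠ Finset.Icc (1:ℤ) (n:ℤ) := by
  intro h
  have h2 : (2 : ℤ) ∈ residueOne n d := by
    rw [h, Finset.mem_Icc]
    omega
  have := Int.le_of_dvd (by norm_num) (mem_residueOne.1 h2).2
  omega

theorem isCoatomIn_residueOne {n p : ℕ} (hn : 2 ≤ n) (hp : p.Prime) (hpn : p ∣ n - 1) :
    IsCoatomIn n (residueOne n p) := by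
  have hp2 : (2 : ℤ) ≤ p := by exact_mod_cast hp.two_le
  have hpn' : (p : ℤ) ∣ (n : ℤ) - 1 := by
    have := Int.natCast_dvd_natCast.2 hpn
    rwa [Nat.cast_sub (by omega), Nat.cast_one] at this
  have hple : p ≤ n - 1 := Nat.le_of_dvd (by omega) hpn
  refine ⟨isAP_residueOne (by omega) (by omega) hpn', residueOne_subset _ _,
    residueOne_ne_Icc hn hp2, fun y hy hyn hxy => ?_⟩
  obtain ⟨r, hr, -, rfl⟩ := hy.eq_residueOne hyn
    (hxy.subset (mem_residueOne.2 ⟨by omega, by simp⟩))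
    (hxy.subset (mem_residueOne.2 ⟨by omega, hpn'⟩))
  have hrp : r ∣ p := by
    simpa using (mem_residueOne.1 (hxy.subset
      (mem_residueOne.2 ⟨by omega, by simp⟩ : (1 + (p : ℤ)) ∈ residueOne n p))).2
  lift r to ℕ using by omega
  rcases (Nat.dvd_prime hp).1 (Int.natCast_dvd_natCast.1 hrp) with rfl | rfl
  · simp [residueOne]
  · exact absurd rfl hxy.ne

theorem IsCoatomIn.eq_of_subset {n : ℕ} {x y : Finset ℤ} (hx : IsCoatomIn n x) (hy : IsAP y)
    (hyn : y ⊆ Finset.Icc (1:ℤ) (n:ℤ)) (hne : y ≠ Finset.Icc (1:ℤ) (n:ℤ)) (hxy : x ⊆ y) :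
    x = y := by
  by_contra h
  exact hne (hx.2.2.2 y hy hyn (hxy.ssubset_of_ne h))

theorem IsCoatomIn.eq_or {n : ℕ} (hn : 2 ≤ n) {x : Finset ℤ} (hx : IsCoatomIn n x) :
    x = Finset.Icc (1:ℤ) ((n:ℤ) - 1) ∨ x = Finset.Icc (2:ℤ) (n:ℤ) ∨
      ∃ q : ℕ, q.Prime ∧ q ∣ n - 1 ∧ x = residueOne n q := by
  by_cases h1 : (1 : ℤ) ∈ x
  swap
  · obtain ⟨hy, hyn, hne, -⟩ := isCoatomIn_Icc_right (n := n) (by omega)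
    refine Or.inr (Or.inl (hx.eq_of_subset hy hyn hne fun v hv => ?_))
    have hv1 := Finset.mem_Icc.1 (hx.2.1 hv)
    have : v ≠ 1 := fun h => h1 (h ▸ hv)
    rw [Finset.mem_Icc]
    omega
  by_cases h2 : (n : ℤ) ∈ x
  swap
  · obtain ⟨hy, hyn, hne, -⟩ := isCoatomIn_Icc_left (n := n) (by omega)
    refine Or.inl (hx.eq_of_subset hy hyn hne fun v hv => ?_)
    have hv1 := Finset.mem_Icc.1 (hx.2.1 hv)
    have : v ≠ n := fun h => h2 (h ▸ hv)
    rw [Finset.mem_Icc]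
    omega
  obtain ⟨r, hr, hrn, hxr⟩ := hx.1.eq_residueOne hx.2.1 h1 h2
  lift r to ℕ using by omega
  have hr1 : r ≠ 1 := by
    rintro rfl
    exact hx.2.2.1 (by simp [hxr, residueOne])
  obtain ⟨q, hq, hqr⟩ := Nat.exists_prime_and_dvd hr1
  have hqn : q ∣ n - 1 := by
    refine hqr.trans (Int.natCast_dvd_natCast.1 ?_)
    rwa [Nat.cast_sub (by omega), Nat.cast_one]
  obtain ⟨hy, hyn, hne, -⟩ := isCoatomIn_residueOne hn hq hqn
  refine Or.inr (Or.inr ⟨q, hq, hqn, hx.eq_of_subset hy hyn hne fun v hv => ?_⟩)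
  rw [hxr, mem_residueOne] at hv
  exact mem_residueOne.2 ⟨hv.1, (Int.natCast_dvd_natCast.2 hqr).trans hv.2⟩

theorem IsCoatomIn.mem_of_sq_dvd {n p : ℕ} (hn : 2 ≤ n) (hp : p.Prime) (hpn : p ^ 2 ∣ n - 1)
    {x : Finset ℤ} (hx : IsCoatomIn n x) : ((1 + (n - 1) / p : ℕ) : ℤ) ∈ x := by
  obtain ⟨k, hk⟩ := hpn
  have hdiv : (n - 1) / p = p * k := by
    rw [hk, pow_two, mul_assoc, Nat.mul_div_cancel_left _ hp.pos]
  have hlt : (n - 1) / p < n - 1 := Nat.div_lt_self (by omega) hp.one_lt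
  have hpos : 0 < (n - 1) / p := by
    refine Nat.pos_of_ne_zero fun h => ?_
    have : n - 1 = p * (p * k) := by rw [hk, pow_two, mul_assoc]
    rw [← hdiv, h, mul_zero] at this
    omega
  rcases hx.eq_or hn with rfl | rfl | ⟨q, hq, hqn, rfl⟩
  · rw [Finset.mem_Icc]
    omega
  · rw [Finset.mem_Icc]
    omega
  · refine mem_residueOne.2 ⟨by omega, ?_⟩
    rw [Nat.cast_add, Nat.cast_one, add_sub_cancel_left, Int.natCast_dvd_natCast, hdiv]
    rw [hk, pow_two, mul_assoc] at hqn
    rcases hq.dvd_mul.1 hqn with h | h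
    · exact h.mul_right k
    · exact h

theorem Nat.dvd_of_squarefree_of_forall_prime {m k : ℕ} (hm : Squarefree m)
    (h : ∀ p : ℕ, p.Prime → p ∣ m → p ∣ k) : m ∣ k := by
  rw [← Nat.prod_primeFactors_of_squarefree hm]
  exact Finset.prod_primes_dvd k (fun p hp => (Nat.prime_of_mem_primeFactors hp).prime)
    fun p hp => h p (Nat.prime_of_mem_primeFactors hp) (Nat.dvd_of_mem_primeFactors hp)

/-- For `n ≥ 4`, the meet (intersection) of all coatoms of `L_n` is `∅` if and only
if `n-1` is squarefree; moreover if `p` is a prime with `p² ∣ n-1`, then the integer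
`1 + (n-1)/p` belongs to every coatom of `L_n`. -/
theorem meet_all_coatoms (n : ℕ) (hn : 4 ≤ n) :
    (apMeet (Finset.Icc (1:ℤ) (n:ℤ))
        ((Finset.Icc (1:ℤ) (n:ℤ)).powerset.filter (IsCoatomIn n)) = ∅ ↔
      Squarefree (n - 1)) ∧
    (∀ p : ℕ, p.Prime → p^2 ∣ (n - 1) →
      ∀ x : Finset ℤ, IsCoatomIn n x → ((1 + (n-1)/p : ℕ) : ℤ) ∈ x) := by
  have hmem : ∀ p : ℕ, p.Prime → p^2 ∣ (n - 1) →
      ∀ x : Finset ℤ, IsCoatomIn n x → ((1 + (n-1)/p : ℕ) : ℤ) ∈ x :=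
    fun p hp hpn x hx => hx.mem_of_sq_dvd (by omega) hp hpn
  refine ⟨⟨fun h => ?_, fun h => ?_⟩, hmem⟩
  · rw [Nat.squarefree_iff_prime_squarefree]
    intro p hp hpn
    rw [← pow_two] at hpn
    have hv : ((1 + (n-1)/p : ℕ) : ℤ) ∈ apMeet (Finset.Icc (1:ℤ) (n:ℤ))
        ((Finset.Icc (1:ℤ) (n:ℤ)).powerset.filter (IsCoatomIn n)) := by
      refine mem_apMeet.2 ⟨?_, fun x hx => hmem p hp hpn x (Finset.mem_filter.1 hx).2⟩
      have hx := isCoatomIn_Icc_right (n := n) (by omega)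
      exact hx.2.1 (hmem p hp hpn _ hx)
    simp [h] at hv
  · refine Finset.eq_empty_of_forall_notMem fun v hv => ?_
    have hv' : ∀ x, IsCoatomIn n x → v ∈ x := fun x hx =>
      (mem_apMeet.1 hv).2 x (Finset.mem_filter.2 ⟨Finset.mem_powerset.2 hx.2.1, hx⟩)
    have h1 := Finset.mem_Icc.1 (hv' _ (isCoatomIn_Icc_left (by omega)))
    have h2 := Finset.mem_Icc.1 (hv' _ (isCoatomIn_Icc_right (by omega)))
    have hdvd : n - 1 ∣ (v - 1).toNat := by
      refine Nat.dvd_of_squarefree_of_forall_prime h fun p hp hpn => ?_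
      have := (mem_residueOne.1 (hv' _ (isCoatomIn_residueOne (by omega) hp hpn))).2
      rwa [← Int.natCast_dvd_natCast, Int.toNat_of_nonneg (by omega)]
    have := Nat.le_of_dvd (by omega) hdvd
    omega
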